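/- For all integers n ≥ 1 and 0 ≤ m with 2m ≤ n, consider the quotient sl₂(ℂ)-module V^⊗n/Cₙ (the degree-n part of the necklace Lie algebra in 2 variables). The space of its highest weight vectors of weight n − 2m, namely {v̄ ∈ V^⊗n/Cₙ : H·v̄ = (n − 2m)·v̄ and E·v̄ = 0}, has complex dimension binom(n,m) − binom(n,m−1) − S(n,m) + S(n,m−1). Equivalently, the simple sl₂(ℂ)-module of highest weight n − 2m occurs in V^⊗n/Cₙ with this multiplicity. -/

import Mathlib

open scoped TensorProduct

noncomputable section

/-- V = ℂ². -/
abbrev V2 : Type := Fin 2 → ℂ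

/-- The basis vectors e₁ = `bvec 0`, e₂ = `bvec 1` of V = ℂ². -/
def bvec (j : Fin 2) : V2 := Pi.single j 1

/-- The matrix of H : H·e₁ = −e₁, H·e₂ = e₂. -/
def Hmat : Matrix (Fin 2) (Fin 2) ℂ := !![-1, 0; 0, 1]

/-- The matrix of E : E·e₁ = e₂, E·e₂ = 0. -/
def Emat : Matrix (Fin 2) (Fin 2) ℂ := !![0, 0; 1, 0]

/-- The matrix of F : F·e₂ = e₁, F·e₁ = 0. -/
def Fmat : Matrix (Fin 2) (Fin 2) ℂ := !![0, 1; 0, 0]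

/-- The action of a matrix `g` on the `n`-fold tensor power of V = ℂ² by derivations:
`g·(v₁⊗⋯⊗vₙ) = Σᵢ v₁⊗⋯⊗(g·vᵢ)⊗⋯⊗vₙ`. -/
def derivAction (n : ℕ) (g : Matrix (Fin 2) (Fin 2) ℂ) :
    (⨂[ℂ] _ : Fin n, V2) →ₗ[ℂ] ⨂[ℂ] _ : Fin n, V2 :=
  ∑ i : Fin n, PiTensorProduct.map
    (Function.update (fun _ : Fin n => (LinearMap.id : V2 →ₗ[ℂ] V2)) i g.mulVecLin)

/-- `Cyc n` : the subspace Cₙ ⊆ V^⊗n spanned by all `v₁⊗…⊗vₙ − v₂⊗…⊗vₙ⊗v₁`. -/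
def Cyc (n : ℕ) : Submodule ℂ (⨂[ℂ] _ : Fin n, V2) :=
  Submodule.span ℂ {x | ∃ v : Fin n → V2,
    x = PiTensorProduct.tprod ℂ v -
        PiTensorProduct.tprod ℂ (fun i => v (finRotate n i))}

/-- S(n,m) := Σ_{ℓ | n, n | ℓm} ((ℓ−1)/ℓ)·Σ_{k | gcd(ℓ, ℓm/n)} μ(k)·binom(ℓ/k, ℓm/(kn)),
where μ is the Möbius function. -/
def S (n m : ℕ) : ℚ :=
  ∑ ℓ ∈ n.divisors.filter (fun ℓ => n ∣ ℓ * m),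
    (((ℓ : ℚ) - 1) / (ℓ : ℚ)) *
      ∑ k ∈ (Nat.gcd ℓ (ℓ * m / n)).divisors,
        ((ArithmeticFunction.moebius k : ℤ) : ℚ) * ((ℓ / k).choose (ℓ * m / (k * n)) : ℚ)

open Module

/-- A finite-dimensional representation of `sl₂` has no primitive vector of negative weight. -/
theorem eq_zero_of_primitive_of_neg_weight {N : Type*} [AddCommGroup N] [Module ℂ N]
    [FiniteDimensional ℂ N] {H E F : Module.End ℂ N} (hEF : E * F - F * E = H)
    (hHE : H * E - E * H = 2 • E) (hHF : H * F - F * H = -(2 • F)) {v : N} {c : ℕ}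
    (hvH : H v = (-((c : ℂ) + 1)) • v) (hvE : E v = 0) : v = 0 := by
  by_contra hv
  have hc : (c : ℂ) + 1 ≠ 0 := by exact_mod_cast Nat.succ_ne_zero c
  let _ : LieRing (Module.End ℂ N) := LieRing.ofAssociativeRing
  have ht : IsSl2Triple H E F := by
    refine ⟨fun h0 => ?_, hEF, hHE, hHF⟩
    rw [h0, LinearMap.zero_apply] at hvH
    exact smul_ne_zero (neg_ne_zero.2 hc) hv hvH.symm
  have hp : ht.HasPrimitiveVectorWith v (-((c : ℂ) + 1)) := ⟨hv, hvH, hvE⟩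
  obtain ⟨k, hk⟩ := hp.exists_nat
  have : ((c + 1 + k : ℕ) : ℂ) = 0 := by push_cast; rw [← hk]; ring
  have := Nat.cast_eq_zero.mp this
  omega

/-- A linear functional of positive weight that vanishes on the range of the raising operator of a
finite-dimensional representation of `sl₂` is zero. -/
theorem dual_eq_zero_of_comp_raising_eq_zero {M : Type*} [AddCommGroup M] [Module ℂ M]
    [FiniteDimensional ℂ M] {H E F : Module.End ℂ M} (hEF : ⁅E, F⁆ = H) (hHE : ⁅H, E⁆ = 2 • E)
    (hHF : ⁅H, F⁆ = -(2 • F)) {φ : Module.Dual ℂ M} {c : ℕ} (hφH : φ ∘ₗ H = ((c : ℂ) + 1) • φ)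
    (hφE : φ ∘ₗ E = 0) : φ = 0 := by
  let D : Module.End ℂ M → Module.End ℂ (Module.Dual ℂ M) := fun A => A.dualMap
  have hD (A : Module.End ℂ M) (ψ : Module.Dual ℂ M) (x : M) : D A ψ x = ψ (A x) := rfl
  refine eq_zero_of_primitive_of_neg_weight (H := -D H) (E := D E) (F := D F) (c := c)
    ?_ ?_ ?_ ?_ hφE
  · rw [← hEF]
    ext ψ x
    simp [hD, Ring.lie_def]
  · ext ψ x
    have := congrArg ψ (LinearMap.congr_fun hHE x)
    simp only [Ring.lie_def, LinearMap.sub_apply, Module.End.mul_apply, LinearMap.smul_apply,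
      map_sub, map_nsmul] at this
    simp only [LinearMap.sub_apply, Module.End.mul_apply, LinearMap.neg_apply, map_neg, hD,
      LinearMap.smul_apply]
    rw [← this]; ring
  · ext ψ x
    have := congrArg ψ (LinearMap.congr_fun hHF x)
    simp only [Ring.lie_def, LinearMap.sub_apply, Module.End.mul_apply, LinearMap.smul_apply,
      LinearMap.neg_apply, map_sub, map_neg, map_nsmul] at this
    simp only [LinearMap.sub_apply, Module.End.mul_apply, LinearMap.neg_apply, map_neg, hD,
      LinearMap.smul_apply]
    rw [← this]; ring
  · ext x
    have := LinearMap.congr_fun hφH x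
    simp only [LinearMap.comp_apply, LinearMap.smul_apply] at this
    rw [LinearMap.neg_apply, LinearMap.neg_apply, hD, this, neg_smul, LinearMap.neg_apply,
      LinearMap.smul_apply]

theorem finrank_ker_sub_smul_of_eigenbasis {M ι : Type*} [AddCommGroup M] [Module ℂ M] [Fintype ι]
    (b : Module.Basis ι ℂ M) (w : ι → ℤ) {H : Module.End ℂ M} (hb : ∀ i, H (b i) = (w i : ℂ) • b i)
    (c : ℤ) : Module.finrank ℂ (LinearMap.ker (H - (c : ℂ) • LinearMap.id)) =
      Nat.card {i // w i = c} := by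
  classical
  have hM : FiniteDimensional ℂ M := b.finiteDimensional_of_finite
  have hrank : Module.finrank ℂ (LinearMap.range (H - (c : ℂ) • LinearMap.id)) =
      Fintype.card {i // ((w i : ℂ) - c) ≠ 0} := by
    rw [← Matrix.rank_diagonal, ← Matrix.toLin_toMatrix b b (H - (c : ℂ) • LinearMap.id),
      ← Matrix.rank_eq_finrank_range_toLin]
    congr 1
    ext i j
    rw [LinearMap.toMatrix_apply]
    by_cases hij : i = j
    · subst hij; simp [hb]
    · simp [hb, hij]
  have h := LinearMap.finrank_range_add_finrank_ker (H - (c : ℂ) • LinearMap.id)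
  rw [hrank, Module.finrank_eq_card_basis b] at h
  have h2 : Fintype.card {i // ((w i : ℂ) - c) ≠ 0} = Fintype.card {i // ¬ w i = c} :=
    Fintype.card_congr (Equiv.subtypeEquivRight fun i => by rw [sub_ne_zero]; norm_cast)
  rw [h2, Fintype.card_subtype_compl] at h
  have := Fintype.card_subtype_le (fun i => w i = c)
  rw [Nat.card_eq_fintype_card]
  omega

theorem finrank_highest_weight_add {M ι : Type*} [AddCommGroup M] [Module ℂ M] [Fintype ι]
    {H E F : Module.End ℂ M} (hEF : ⁅E, F⁆ = H) (hHE : ⁅H, E⁆ = 2 • E)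
    (hHF : ⁅H, F⁆ = -(2 • F)) (b : Module.Basis ι ℂ M) (w : ι → ℤ)
    (hb : ∀ i, H (b i) = (w i : ℂ) • b i) (c : ℕ) :
    Module.finrank ℂ ↥(LinearMap.ker (H - (c : ℂ) • LinearMap.id) ⊓ LinearMap.ker E) +
      Nat.card {i // w i = c + 2} = Nat.card {i // w i = c} := by
  classical
  have hM : FiniteDimensional ℂ M := b.finiteDimensional_of_finite
  set P := LinearMap.ker (H - (c : ℂ) • LinearMap.id) with hP
  have memP (x : M) : x ∈ P ↔ H x = (c : ℂ) • x := by
    rw [hP, LinearMap.mem_ker]; simp [sub_eq_zero]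
  set P' := LinearMap.ker (H - ((c + 2 : ℤ) : ℂ) • LinearMap.id) with hP'
  have memP' (x : M) : x ∈ P' ↔ H x = ((c : ℂ) + 2) • x := by
    rw [hP', LinearMap.mem_ker]; simp [sub_eq_zero]
  have hcomm (x : M) : H (E x) = E (H x) + (2 : ℂ) • E x := by
    have := LinearMap.congr_fun hHE x
    simp only [Ring.lie_def, LinearMap.sub_apply, Module.End.mul_apply, LinearMap.smul_apply] at this
    rw [sub_eq_iff_eq_add] at this
    rw [this, add_comm, two_smul, two_smul]
  have hPb (i : ι) (hi : w i = c) : b i ∈ P := by rw [memP, hb, hi]; simp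
  have hP'b (i : ι) (hi : w i = c + 2) : b i ∈ P' := by rw [memP', hb, hi]; simp
  have hmap : P.map E = P' := by
    apply le_antisymm
    · rintro _ ⟨x, hx, rfl⟩
      rw [memP', hcomm, (memP x).1 hx, map_smul, add_smul]
    · by_contra hle
      obtain ⟨y, hy, hy'⟩ := SetLike.not_le_iff_exists.1 hle
      obtain ⟨φ, hφy, hφ⟩ := Submodule.exists_le_ker_of_notMem hy'
      -- the functional agreeing with `φ` on weight `c + 2` and vanishing on the other weights
      set ψ : M →ₗ[ℂ] ℂ := b.constr ℂ fun i => if w i = c + 2 then φ (b i) else 0 with hψ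
      have hψb (i : ι) : ψ (b i) = if w i = c + 2 then φ (b i) else 0 := by
        rw [hψ, Basis.constr_basis]
      have hψH : ψ ∘ₗ H = (((c + 1 : ℕ) : ℂ) + 1) • ψ := by
        refine b.ext fun i => ?_
        simp only [LinearMap.comp_apply, hb, map_smul, LinearMap.smul_apply, hψb]
        split_ifs with hi
        · rw [hi]; push_cast; ring_nf
        · simp
      have hψ0 (x : M) (d : ℂ) (hx : H x = d • x) (hd : d ≠ c + 2) : ψ x = 0 := by
        have h1 := LinearMap.congr_fun hψH x
        simp only [LinearMap.comp_apply, hx, map_smul, LinearMap.smul_apply, smul_eq_mul] at h1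
        have h2 : (d - (c + 2)) * ψ x = 0 := by
          push_cast at h1; linear_combination h1
        exact (mul_eq_zero.1 h2).resolve_left (sub_ne_zero.2 hd)
      have hψφ (x : M) (hx : x ∈ P') : ψ x = φ x := by
        rw [memP'] at hx
        rw [← b.sum_repr x, map_sum, map_sum]
        refine Finset.sum_congr rfl fun i _ => ?_
        rw [map_smul, map_smul, hψb]
        split_ifs with hi
        · rfl
        · have h1 := congrArg (fun z => b.repr z i) hx
          rw [← b.sum_repr x] at h1
          simp only [map_sum, map_smul, hb, Basis.repr_self, Finsupp.coe_finsetSum,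
            Finset.sum_apply, Finsupp.smul_apply, Finsupp.single_apply, smul_eq_mul] at h1
          simp only [mul_ite, mul_one, mul_zero, Finset.sum_ite_eq', Finset.mem_univ, if_true] at h1
          have h2 : (b.repr x i) * ((w i : ℂ) - (c + 2)) = 0 := by linear_combination h1
          have h3 : (w i : ℂ) - (c + 2) ≠ 0 := by
            rw [sub_ne_zero]; exact_mod_cast hi
          rw [(mul_eq_zero.1 h2).resolve_right h3]; simp
      have hψE : ψ ∘ₗ E = 0 := by
        refine b.ext fun i => ?_
        have hEb : H (E (b i)) = ((w i : ℂ) + 2) • E (b i) := by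
          rw [hcomm, hb, map_smul, add_smul]
        by_cases hi : w i = c
        · rw [LinearMap.comp_apply, hψφ _ (by rw [memP', hEb, hi]; simp)]
          exact hφ ⟨b i, hPb i hi, rfl⟩
        · exact hψ0 _ _ hEb (by simpa using by exact_mod_cast hi)
      have h0 := dual_eq_zero_of_comp_raising_eq_zero hEF hHE hHF hψH hψE
      exact hφy (by rw [← hψφ y hy, h0]; rfl)
  have h1 := LinearMap.finrank_range_add_finrank_ker (E.domRestrict P)
  rw [LinearMap.range_domRestrict, hmap, hP', finrank_ker_sub_smul_of_eigenbasis b w hb] at h1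
  have h2 : Module.finrank ℂ P = Nat.card {i // w i = c} := by
    rw [← finrank_ker_sub_smul_of_eigenbasis b w hb c, hP, Int.cast_natCast]
  have h3 : Module.finrank ℂ (LinearMap.ker (E.domRestrict P)) =
      Module.finrank ℂ ↥(P ⊓ LinearMap.ker E) := by
    rw [LinearMap.ker_domRestrict, ← Submodule.finrank_map_subtype_eq P,
      Submodule.map_comap_subtype]
  rw [← h3]; omega

section DerivAction

variable {n : ℕ}

theorem derivAction_tprod (g : Matrix (Fin 2) (Fin 2) ℂ) (v : Fin n → V2) :
    derivAction n g (PiTensorProduct.tprod ℂ v) =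
      ∑ i, PiTensorProduct.tprod ℂ (Function.update v i (g.mulVec (v i))) := by
  rw [derivAction, LinearMap.sum_apply]
  refine Finset.sum_congr rfl fun i _ => ?_
  rw [PiTensorProduct.map_tprod]
  congr 1
  ext j
  obtain rfl | hij := eq_or_ne j i
  · simp
  · simp [hij]

theorem derivAction_comp (A B : Matrix (Fin 2) (Fin 2) ℂ) :
    derivAction n A ∘ₗ derivAction n B =
      derivAction n B ∘ₗ derivAction n A + derivAction n (A * B - B * A) := by
  let D (A : Matrix (Fin 2) (Fin 2) ℂ) (i : Fin n) : Module.End ℂ (⨂[ℂ] _ : Fin n, V2) :=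
    PiTensorProduct.map
      (Function.update (fun _ : Fin n => (LinearMap.id : V2 →ₗ[ℂ] V2)) i A.mulVecLin)
  have hD (A) : (derivAction n A : Module.End ℂ (⨂[ℂ] _ : Fin n, V2)) = ∑ i, D A i := rfl
  have hcomm (i j : Fin n) (hij : i ≠ j) : D A i * D B j = D B j * D A i := by
    rw [← PiTensorProduct.map_mul, ← PiTensorProduct.map_mul]
    congr 1
    ext1 k
    obtain rfl | hk := eq_or_ne k i
    · simp [hij, ← Module.End.one_eq_id]
    · simp [hk, ← Module.End.one_eq_id]
  have hmul (A B) (i : Fin n) : D A i * D B i = D (A * B) i := by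
    rw [← PiTensorProduct.map_mul]
    congr 1
    ext1 k
    obtain rfl | hk := eq_or_ne k i
    · simp [Matrix.mulVecLin_mul, Module.End.mul_eq_comp]
    · simp [hk, ← Module.End.one_eq_id]
  have hadd (A B) (i : Fin n) : D (A + B) i = D A i + D B i := by
    simp only [D, Matrix.mulVecLin_add, PiTensorProduct.map_update_add]
  rw [← Module.End.mul_eq_comp, ← Module.End.mul_eq_comp, hD, hD, hD, Finset.sum_mul_sum,
    Finset.sum_mul_sum, Finset.sum_comm (f := fun i j => D B i * D A j), ← Finset.sum_add_distrib]
  refine Finset.sum_congr rfl fun i _ => ?_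
  rw [← Fintype.sum_ite_eq' i fun j => D (A * B - B * A) i]
  rw [← Finset.sum_add_distrib]
  refine Finset.sum_congr rfl fun j _ => ?_
  obtain rfl | hij := eq_or_ne j i
  · rw [if_pos rfl, hmul, hmul, ← hadd, add_sub_cancel]
  · rw [if_neg hij, hcomm i j hij.symm, add_zero]

theorem derivAction_smul (c : ℂ) (A : Matrix (Fin 2) (Fin 2) ℂ) :
    derivAction n (c • A) = c • derivAction n A := by
  rw [derivAction, derivAction, Finset.smul_sum]
  refine Finset.sum_congr rfl fun i _ => ?_
  rw [← PiTensorProduct.map_update_smul]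
  congr 2
  ext; simp

theorem Cyc_le_comap_derivAction (g : Matrix (Fin 2) (Fin 2) ℂ) :
    Cyc n ≤ (Cyc n).comap (derivAction n g) := by
  rw [Cyc, Submodule.span_le]
  rintro _ ⟨v, rfl⟩
  rw [SetLike.mem_coe, Submodule.mem_comap, map_sub, derivAction_tprod, derivAction_tprod,
    ← Equiv.sum_comp (finRotate n), ← Finset.sum_sub_distrib]
  refine Submodule.sum_mem _ fun i _ => Submodule.subset_span
    ⟨Function.update v (finRotate n i) (g.mulVec (v (finRotate n i))), ?_⟩
  congr 2
  ext1 j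
  obtain rfl | hij := eq_or_ne j i
  · simp
  · simp [hij]

/-- The basis of words in `e₁`, `e₂` of the tensor power. -/
def wordBasis (n : ℕ) : Module.Basis (Fin n → Fin 2) ℂ (⨂[ℂ] _ : Fin n, V2) :=
  Basis.piTensorProduct fun _ => Pi.basisFun ℂ (Fin 2)

theorem wordBasis_apply (w : Fin n → Fin 2) :
    wordBasis n w = PiTensorProduct.tprod ℂ fun i => bvec (w i) := by
  simp [wordBasis, Basis.piTensorProduct_apply, bvec]

/-- The cyclic shift of words. -/
def wordShift (n : ℕ) : Equiv.Perm (Fin n → Fin 2) := (finRotate n).symm.arrowCongr (Equiv.refl _)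

theorem wordShift_apply (w : Fin n → Fin 2) (i : Fin n) :
    wordShift n w i = w (finRotate n i) := rfl

/-- The weight of a word under the action of `H`. -/
def wordWeight (w : Fin n → Fin 2) : ℤ := ∑ i, (2 * ((w i : ℕ) : ℤ) - 1)

theorem wordWeight_wordShift (w : Fin n → Fin 2) : wordWeight (wordShift n w) = wordWeight w := by
  simp only [wordWeight, wordShift_apply]
  exact Equiv.sum_comp (finRotate n) fun i => (2 * ((w i : ℕ) : ℤ) - 1)

theorem derivAction_Hmat_wordBasis (w : Fin n → Fin 2) :
    derivAction n Hmat (wordBasis n w) = (wordWeight w : ℂ) • wordBasis n w := by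
  have h (j : Fin 2) : Hmat.mulVec (bvec j) = ((2 * ((j : ℕ) : ℂ) - 1) : ℂ) • bvec j := by
    revert j
    rw [Fin.forall_fin_two]
    constructor <;> ext k <;> fin_cases k <;> norm_num [Hmat, bvec, Matrix.mulVec, dotProduct]
  rw [wordBasis_apply, derivAction_tprod, wordWeight, Int.cast_sum, Finset.sum_smul]
  refine Finset.sum_congr rfl fun i _ => ?_
  rw [h, MultilinearMap.map_update_smul, Function.update_eq_self]
  simp

/-- Necklaces: words up to cyclic shift. -/
abbrev Necklace (n : ℕ) : Type := Quotient (Equiv.Perm.SameCycle.setoid (wordShift n))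

/-- The necklace of a word. -/
def Necklace.mk (w : Fin n → Fin 2) : Necklace n := Quotient.mk _ w

theorem Necklace.exists_mk (x : Necklace n) : ∃ w, Necklace.mk w = x := Quotient.exists_rep x

theorem Necklace.mk_wordShift (w : Fin n → Fin 2) :
    Necklace.mk (wordShift n w) = Necklace.mk w :=
  Quotient.sound (s := Equiv.Perm.SameCycle.setoid (wordShift n)) ⟨-1, by simp⟩

/-- A function on words that is invariant under the cyclic shift descends to necklaces. -/
def Necklace.lift {β : Type*} (f : (Fin n → Fin 2) → β) (hf : ∀ w, f (wordShift n w) = f w) :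
    Necklace n → β :=
  Quotient.lift f fun a b ⟨k, hk⟩ => by
    have h (k : ℕ) (w) : f ((wordShift n ^ k) w) = f w := by
      induction k with
      | zero => simp
      | succ k ih => rw [pow_succ', Equiv.Perm.mul_apply, hf, ih]
    rw [← hk]
    cases k with
    | ofNat k => exact (h k a).symm
    | negSucc k =>
      rw [zpow_negSucc, ← h (k + 1) (((wordShift n) ^ (k + 1))⁻¹ a), ← Equiv.Perm.mul_apply,
        mul_inv_cancel, Equiv.Perm.one_apply]

/-- The weight of a necklace under the action of `H`. -/
def Necklace.weight : Necklace n → ℤ := Necklace.lift wordWeight wordWeight_wordShift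

/-- The linear map sending a word to its necklace. -/
def toNecklace (n : ℕ) : (⨂[ℂ] _ : Fin n, V2) →ₗ[ℂ] Necklace n →₀ ℂ :=
  (wordBasis n).constr ℂ fun w => Finsupp.single (.mk w) 1

theorem toNecklace_wordBasis (w : Fin n → Fin 2) :
    toNecklace n (wordBasis n w) = Finsupp.single (.mk w) 1 := by
  rw [toNecklace, Module.Basis.constr_basis]

theorem Cyc_le_ker_toNecklace : Cyc n ≤ LinearMap.ker (toNecklace n) := by
  rw [Cyc, Submodule.span_le]
  rintro _ ⟨v, rfl⟩
  let ρ : (⨂[ℂ] _ : Fin n, V2) →ₗ[ℂ] ⨂[ℂ] _ : Fin n, V2 :=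
    (PiTensorProduct.reindex ℂ (fun _ => V2) (finRotate n).symm).toLinearMap
  have hρ (v : Fin n → V2) : ρ (PiTensorProduct.tprod ℂ v) =
      PiTensorProduct.tprod ℂ fun i => v (finRotate n i) :=
    PiTensorProduct.reindex_tprod _ _
  have h : toNecklace n ∘ₗ ρ = toNecklace n := by
    refine (wordBasis n).ext fun w => ?_
    have : ρ (wordBasis n w) = wordBasis n (wordShift n w) := by
      rw [wordBasis_apply, hρ, wordBasis_apply]; rfl
    rw [LinearMap.comp_apply, this, toNecklace_wordBasis, toNecklace_wordBasis,
      Necklace.mk_wordShift]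
  rw [SetLike.mem_coe, LinearMap.mem_ker, map_sub, ← hρ, ← LinearMap.comp_apply, h, sub_self]

/-- The class of a necklace in the quotient of the tensor power by cyclic shifts. -/
def Necklace.toQuot : Necklace n → (⨂[ℂ] _ : Fin n, V2) ⧸ Cyc n :=
  Necklace.lift (fun w => (Cyc n).mkQ (wordBasis n w)) fun w => by
    rw [eq_comm, ← sub_eq_zero, ← map_sub, Submodule.mkQ_apply, Submodule.Quotient.mk_eq_zero]
    refine Submodule.subset_span ⟨fun i => bvec (w i), ?_⟩
    rw [wordBasis_apply, wordBasis_apply]; rfl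

theorem Necklace.toQuot_mk (w : Fin n → Fin 2) :
    (Necklace.mk w).toQuot = (Cyc n).mkQ (wordBasis n w) := rfl

/-- The necklaces form a basis of the quotient of the tensor power by cyclic shifts. -/
def necklaceBasis (n : ℕ) : Module.Basis (Necklace n) ℂ ((⨂[ℂ] _ : Fin n, V2) ⧸ Cyc n) :=
  .ofRepr <| LinearEquiv.ofLinearMap ((Cyc n).liftQ (toNecklace n) Cyc_le_ker_toNecklace)
    (Finsupp.lift _ ℂ _ Necklace.toQuot)
    (by
      ext x : 2
      obtain ⟨w, rfl⟩ := x.exists_mk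
      simp [Necklace.toQuot_mk, toNecklace_wordBasis])
    (by
      apply Submodule.linearMap_qext
      refine (wordBasis n).ext fun w => ?_
      simp [Necklace.toQuot_mk, toNecklace_wordBasis])

theorem necklaceBasis_mk (w : Fin n → Fin 2) :
    necklaceBasis n (.mk w) = (Cyc n).mkQ (wordBasis n w) := by
  simp [necklaceBasis, Necklace.toQuot_mk]

/-- The action on the quotient of the tensor power by cyclic shifts. -/
def quotAction (n : ℕ) (g : Matrix (Fin 2) (Fin 2) ℂ) :
    Module.End ℂ ((⨂[ℂ] _ : Fin n, V2) ⧸ Cyc n) :=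
  (Cyc n).mapQ (Cyc n) (derivAction n g) (Cyc_le_comap_derivAction g)

theorem quotAction_lie {A B C : Matrix (Fin 2) (Fin 2) ℂ} {c : ℂ} (h : A * B - B * A = c • C) :
    ⁅quotAction n A, quotAction n B⁆ = c • quotAction n C := by
  rw [Ring.lie_def, sub_eq_iff_eq_add']
  refine Submodule.linearMap_qext _ (LinearMap.ext fun v => ?_)
  have := LinearMap.congr_fun (derivAction_comp (n := n) A B) v
  rw [h, derivAction_smul] at this
  simp only [LinearMap.comp_apply, LinearMap.add_apply, LinearMap.smul_apply] at this
  simp only [quotAction, LinearMap.comp_apply, LinearMap.add_apply, Module.End.mul_apply,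
    LinearMap.smul_apply, Submodule.mkQ_apply, Submodule.mapQ_apply]
  rw [this, Submodule.Quotient.mk_add, Submodule.Quotient.mk_smul]

theorem quotAction_Hmat_necklaceBasis (x : Necklace n) :
    quotAction n Hmat (necklaceBasis n x) = (x.weight : ℂ) • necklaceBasis n x := by
  obtain ⟨w, rfl⟩ := x.exists_mk
  rw [necklaceBasis_mk, Submodule.mkQ_apply, quotAction, Submodule.mapQ_apply,
    derivAction_Hmat_wordBasis]
  rfl

theorem map_mkQ_highest_weight (c : ℂ) :
    (Submodule.comap (derivAction n Hmat - c • LinearMap.id) (Cyc n) ⊓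
      Submodule.comap (derivAction n Emat) (Cyc n)).map (Cyc n).mkQ =
    LinearMap.ker (quotAction n Hmat - c • LinearMap.id) ⊓ LinearMap.ker (quotAction n Emat) := by
  have h : Submodule.comap (derivAction n Hmat - c • LinearMap.id) (Cyc n) ⊓
      Submodule.comap (derivAction n Emat) (Cyc n) =
    (LinearMap.ker (quotAction n Hmat - c • LinearMap.id) ⊓
      LinearMap.ker (quotAction n Emat)).comap (Cyc n).mkQ := by
    ext x
    simp only [Submodule.mem_inf, Submodule.mem_comap, LinearMap.mem_ker, LinearMap.sub_apply,
      LinearMap.smul_apply, LinearMap.id_apply, quotAction, Submodule.mkQ_apply,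
      Submodule.mapQ_apply]
    rw [← Submodule.Quotient.mk_smul, ← Submodule.Quotient.mk_sub, Submodule.Quotient.mk_eq_zero,
      Submodule.Quotient.mk_eq_zero]
  rw [h, Submodule.map_comap_eq_of_surjective (Submodule.mkQ_surjective _)]

instance : Finite (Necklace n) := Quotient.finite _

theorem finrank_map_mkQ_highest_weight_add (c : ℕ) :
    Module.finrank ℂ
      ↥((Submodule.comap (derivAction n Hmat - (c : ℂ) • LinearMap.id) (Cyc n) ⊓
         Submodule.comap (derivAction n Emat) (Cyc n)).map (Cyc n).mkQ) +
      Nat.card {x : Necklace n // x.weight = c + 2} = Nat.card {x : Necklace n // x.weight = c} := by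
  have := Fintype.ofFinite (Necklace n)
  rw [map_mkQ_highest_weight]
  refine finrank_highest_weight_add (F := quotAction n Fmat) ?_ ?_ ?_ (necklaceBasis n) _
    quotAction_Hmat_necklaceBasis c
  · rw [quotAction_lie (C := Hmat) (c := 1), one_smul]
    ext i j; fin_cases i <;> fin_cases j <;> simp [Hmat, Emat, Fmat]
  · rw [quotAction_lie (C := Emat) (c := 2), two_smul, two_smul]
    ext i j; fin_cases i <;> fin_cases j <;> norm_num [Hmat, Emat, Fmat]
  · rw [quotAction_lie (C := Fmat) (c := -2)]
    · module
    ext i j; fin_cases i <;> fin_cases j <;> norm_num [Hmat, Emat, Fmat]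

end DerivAction

section Counting

/-- The number of cycles of a permutation that satisfy a given property is the sum, over the points
satisfying it, of the inverses of their periods. -/
theorem card_sameCycle_quotient_eq_sum {α : Type*} [Fintype α] (σ : Equiv.Perm α)
    (p : Quotient (Equiv.Perm.SameCycle.setoid σ) → Prop)
    [DecidablePred fun a => p (Quotient.mk _ a)] :
    (Nat.card {x // p x} : ℚ) =
      ∑ a : α with p (Quotient.mk _ a), ((Function.minimalPeriod σ a : ℕ) : ℚ)⁻¹ := by
  classical
  let Q := Quotient (Equiv.Perm.SameCycle.setoid σ)
  let π : α → Q := Quotient.mk _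
  have := Fintype.ofFinite Q
  have hcard (a : α) : (Finset.univ.filter fun b => π b = π a).card = Function.minimalPeriod σ a := by
    have h := MulAction.minimalPeriod_eq_card σ a
    change Function.minimalPeriod σ a = _ at h
    rw [h, ← Fintype.card_coe]
    refine Fintype.card_congr (Equiv.subtypeEquivRight fun b => ?_)
    rw [Finset.mem_filter_univ, eq_comm, Quotient.eq (r := Equiv.Perm.SameCycle.setoid σ),
      MulAction.mem_orbit_iff]
    constructor
    · rintro ⟨k, hk⟩
      exact ⟨⟨σ ^ k, k, rfl⟩, hk⟩
    · rintro ⟨⟨_, k, rfl⟩, hk⟩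
      exact ⟨k, hk⟩
  rw [Nat.card_eq_fintype_card, Fintype.card_subtype,
    ← Finset.sum_fiberwise_of_maps_to (t := Finset.univ.filter p) (g := π) (by simp [π]),
    Finset.card_eq_sum_ones, Nat.cast_sum]
  refine Finset.sum_congr rfl fun x hx => ?_
  obtain ⟨a, rfl⟩ := Quotient.exists_rep x
  rw [Finset.mem_filter_univ] at hx
  have h1 : (Finset.univ.filter fun b => p (π b)).filter (fun b => π b = π a) =
      Finset.univ.filter fun b => π b = π a := by
    ext b
    simp only [Finset.mem_filter, Finset.mem_univ, true_and, and_iff_right_iff_imp]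
    intro hb
    rw [hb]; exact hx
  change _ = ∑ b ∈ (Finset.univ.filter fun b => p (π b)).filter (fun b => π b = π a), _
  rw [h1, Finset.sum_congr rfl (g := fun _ => ((Function.minimalPeriod σ a : ℕ) : ℚ)⁻¹),
    Finset.sum_const, hcard, nsmul_eq_mul, mul_inv_cancel₀, Nat.cast_one]
  · have : 0 < (Finset.univ.filter fun b => π b = π a).card :=
      Finset.card_pos.2 ⟨a, by simp⟩
    rw [hcard] at this
    exact_mod_cast this.ne'
  · intro b hb
    rw [Finset.mem_filter_univ] at hb
    rw [← hcard, ← hcard, hb]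

theorem card_filter_card_fiber_zero_eq (ι : Type*) [Fintype ι] [DecidableEq ι] (k : ℕ) :
    (Finset.univ.filter fun u : ι → Fin 2 => (Finset.univ.filter fun i => u i = 0).card = k).card =
      (Fintype.card ι).choose k := by
  rw [← Finset.card_univ, ← Finset.card_powersetCard]
  refine Finset.card_nbij' (fun u => Finset.univ.filter fun i => u i = 0)
    (fun s i => if i ∈ s then 0 else 1) ?_ ?_ ?_ ?_
  · intro u hu
    simpa [Finset.mem_powersetCard] using hu
  · intro s hs
    simpa [Finset.mem_powersetCard] using hs
  · intro u _
    ext i : 1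
    have : u i = 0 ∨ u i = 1 := by omega
    obtain h | h := this <;> simp [h]
  · intro s _
    ext i
    simp

variable {n : ℕ}

/-- The number of letters `e₁` in a word. -/
def zeroCount (w : Fin n → Fin 2) : ℕ := (Finset.univ.filter fun i => w i = 0).card

theorem wordWeight_eq (w : Fin n → Fin 2) : wordWeight w = n - 2 * zeroCount w := by
  have h (i : Fin n) : (2 * ((w i : ℕ) : ℤ) - 1) = 1 - 2 * (if w i = 0 then 1 else 0) := by
    have : w i = 0 ∨ w i = 1 := by omega
    obtain h | h := this <;> simp [h]
  rw [wordWeight, Finset.sum_congr rfl fun i _ => h i, Finset.sum_sub_distrib, ← Finset.mul_sum,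
    zeroCount, Finset.card_filter]
  simp

theorem iterate_wordShift_apply (k : ℕ) (w : Fin n → Fin 2) (i : Fin n) :
    (wordShift n)^[k] w i = w ⟨(i + k) % n, Nat.mod_lt _ i.pos⟩ := by
  have := i.neZero
  induction k generalizing w with
  | zero => simp [Nat.mod_eq_of_lt i.2]
  | succ k ih =>
    rw [Function.iterate_succ_apply, ih, wordShift_apply, finRotate_apply]
    congr 1
    ext
    simp [Fin.val_add, add_assoc]

theorem isPeriodicPt_wordShift_iff {ℓ : ℕ} (w : Fin n → Fin 2) :
    Function.IsPeriodicPt (wordShift n) ℓ w ↔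
      ∀ i : Fin n, w ⟨(i + ℓ) % n, Nat.mod_lt _ i.pos⟩ = w i := by
  rw [Function.IsPeriodicPt, Function.IsFixedPt, funext_iff]
  simp only [iterate_wordShift_apply]

theorem zeroCount_comp_modNat {q ℓ : ℕ} (u : Fin ℓ → Fin 2) :
    zeroCount (fun i : Fin (q * ℓ) => u i.modNat) = q * zeroCount u := by
  have h : zeroCount (fun i : Fin (q * ℓ) => u i.modNat) =
      ((Finset.univ : Finset (Fin q)) ×ˢ Finset.univ.filter fun i => u i = 0).card := by
    refine Finset.card_equiv finProdFinEquiv.symm fun i => ?_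
    simp [finProdFinEquiv]
  rw [h, Finset.card_product, Finset.card_univ, Fintype.card_fin, zeroCount]

theorem card_zeroCount_isPeriodicPt {q ℓ : ℕ} (hq : 0 < q) (hl : 0 < ℓ) (m : ℕ) :
    (Finset.univ.filter fun w : Fin (q * ℓ) → Fin 2 =>
      zeroCount w = m ∧ Function.IsPeriodicPt (wordShift (q * ℓ)) ℓ w).card =
      if q ∣ m then ℓ.choose (m / q) else 0 := by
  have hle : ℓ ≤ q * ℓ := Nat.le_mul_of_pos_left ℓ hq
  have h : (Finset.univ.filter fun w : Fin (q * ℓ) → Fin 2 =>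
      zeroCount w = m ∧ Function.IsPeriodicPt (wordShift (q * ℓ)) ℓ w).card =
      (Finset.univ.filter fun u : Fin ℓ → Fin 2 => q * zeroCount u = m).card := by
    symm
    refine Finset.card_nbij (fun u i => u i.modNat) ?_ ?_ ?_
    · intro u hu
      simp only [Finset.coe_filter, Finset.mem_univ, true_and, Set.mem_ofPred_eq] at hu ⊢
      refine ⟨by rw [zeroCount_comp_modNat, hu], ?_⟩
      rw [isPeriodicPt_wordShift_iff]
      intro i
      congr 1
      ext
      simp [Fin.modNat]
    · intro u _ v _ huv
      ext1 i
      have := congrFun huv (Fin.castLE hle i)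
      have hi : (Fin.castLE hle i).modNat = i := by
        ext; simp [Fin.modNat, Nat.mod_eq_of_lt i.2]
      simpa only [hi] using this
    · intro w hw
      simp only [Finset.coe_filter, Finset.mem_univ, true_and, Set.mem_ofPred_eq] at hw
      obtain ⟨hw1, hw2⟩ := hw
      rw [isPeriodicPt_wordShift_iff] at hw2
      have hpos : 0 < q * ℓ := Nat.mul_pos hq hl
      let W : ℕ → Fin 2 := fun k => w ⟨k % (q * ℓ), Nat.mod_lt _ hpos⟩
      have hW : Function.Periodic W ℓ := fun k => by
        have := hw2 ⟨k % (q * ℓ), Nat.mod_lt _ hpos⟩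
        simpa [W] using this
      have hw3 : (fun i : Fin (q * ℓ) => w (Fin.castLE hle i.modNat)) = w := by
        ext1 i
        have h1 := hW.map_mod_nat i
        have h2 : (i : ℕ) % ℓ % (q * ℓ) = i % ℓ :=
          Nat.mod_eq_of_lt ((Nat.mod_lt _ hl).trans_le hle)
        simp only [W, h2, Nat.mod_eq_of_lt i.2] at h1
        exact h1
      refine ⟨fun j => w (Fin.castLE hle j), ?_, hw3⟩
      simp only [Finset.coe_filter, Finset.mem_univ, true_and, Set.mem_ofPred_eq]
      rw [← zeroCount_comp_modNat, hw3, hw1]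
  rw [h]
  split_ifs with hqm
  · obtain ⟨k, rfl⟩ := hqm
    rw [Nat.mul_div_cancel_left k hq]
    have := card_filter_card_fiber_zero_eq (Fin ℓ) k
    rw [Fintype.card_fin] at this
    rw [← this]
    congr 1
    ext u
    simp [zeroCount, hq.ne']
  · rw [Finset.card_eq_zero, Finset.filter_eq_empty_iff]
    intro u _ hu
    exact hqm ⟨_, hu.symm⟩

theorem minimalPeriod_wordShift_dvd (w : Fin n → Fin 2) :
    Function.minimalPeriod (wordShift n) w ∣ n := by
  rw [← Function.isPeriodicPt_iff_minimalPeriod_dvd, isPeriodicPt_wordShift_iff]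
  intro i
  congr 1
  ext
  simp [Nat.mod_eq_of_lt i.2]

/-- The number of words with a given number of letters `e₁` and a given minimal period. -/
theorem card_zeroCount_minimalPeriod (hn : 0 < n) {ℓ : ℕ} (hl : ℓ ∣ n) (m : ℕ) :
    ((Finset.univ.filter fun w : Fin n → Fin 2 =>
      zeroCount w = m ∧ Function.minimalPeriod (wordShift n) w = ℓ).card : ℚ) =
    if n ∣ ℓ * m then ∑ k ∈ (Nat.gcd ℓ (ℓ * m / n)).divisors,
        ((ArithmeticFunction.moebius k : ℤ) : ℚ) * ((ℓ / k).choose (ℓ * m / (k * n)) : ℚ)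
      else 0 := by
  let f : ℕ → ℚ := fun d => ((Finset.univ.filter fun w : Fin n → Fin 2 =>
      zeroCount w = m ∧ Function.minimalPeriod (wordShift n) w = d).card : ℚ)
  let g : ℕ → ℚ := fun d => ((Finset.univ.filter fun w : Fin n → Fin 2 =>
      zeroCount w = m ∧ Function.IsPeriodicPt (wordShift n) d w).card : ℚ)
  have hfg : ∀ d > 0, d ∈ {d | d ∣ n} → ∑ i ∈ d.divisors, f i = g d := by
    intro d hd _
    rw [← Nat.cast_sum, Nat.cast_inj, Finset.card_eq_sum_card_fiberwise (t := d.divisors)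
      (f := fun w => Function.minimalPeriod (wordShift n) w)]
    · refine Finset.sum_congr rfl fun i hi => ?_
      congr 1
      ext w
      simp only [Finset.mem_filter, Finset.mem_univ, true_and,
        Function.isPeriodicPt_iff_minimalPeriod_dvd]
      have := Nat.dvd_of_mem_divisors hi
      constructor
      · rintro ⟨h1, rfl⟩; exact ⟨⟨h1, this⟩, rfl⟩
      · rintro ⟨⟨h1, _⟩, h2⟩; exact ⟨h1, h2⟩
    · intro w hw
      simp only [Finset.coe_filter, Finset.mem_univ, true_and, Set.mem_ofPred_eq,
        Function.isPeriodicPt_iff_minimalPeriod_dvd] at hw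
      exact Nat.mem_divisors.2 ⟨hw.2, hd.ne'⟩
  have hl0 : 0 < ℓ := Nat.pos_of_dvd_of_pos hl hn
  have hf := (ArithmeticFunction.sum_eq_iff_sum_smul_moebius_eq_on {d | d ∣ n}
    fun a b hab hb => hab.trans hb).1 hfg ℓ hl0 hl
  rw [Nat.sum_divisorsAntidiagonal (f := fun a b => ArithmeticFunction.moebius a • g b)] at hf
  change f ℓ = _
  rw [← hf]
  obtain ⟨q, rfl⟩ := hl
  have hq : 0 < q := Nat.pos_of_mul_pos_left hn
  have hg (k : ℕ) (hk : k ∈ ℓ.divisors) :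
      g (ℓ / k) = if q * k ∣ m then ((ℓ / k).choose (m / (q * k)) : ℚ) else 0 := by
    obtain ⟨d, rfl⟩ := Nat.dvd_of_mem_divisors hk
    have hk0 : 0 < k := Nat.pos_of_mul_pos_right hl0
    have hd0 : 0 < d := Nat.pos_of_mul_pos_left hl0
    rw [Nat.mul_div_cancel_left d hk0]
    have h := card_zeroCount_isPeriodicPt (Nat.mul_pos hq hk0) hd0 m
    have e : q * k * d = k * d * q := by ring
    rw [e] at h
    simp only [g, h]
    split_ifs <;> simp
  have hdvd : ℓ * q ∣ ℓ * m ↔ q ∣ m := Nat.mul_dvd_mul_iff_left hl0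
  simp only [hdvd, Nat.mul_div_mul_left _ _ hl0]
  split_ifs with hqm
  · have hsub : (Nat.gcd ℓ (m / q)).divisors = ℓ.divisors.filter fun k => q * k ∣ m := by
      ext k
      rw [Nat.mem_divisors, Finset.mem_filter, Nat.mem_divisors, Nat.dvd_gcd_iff,
        Nat.dvd_div_iff_mul_dvd hqm]
      have : Nat.gcd ℓ (m / q) ≠ 0 := (Nat.gcd_pos_of_pos_left _ hl0).ne'
      have := hl0.ne'
      tauto
    rw [hsub, Finset.sum_filter]
    refine Finset.sum_congr rfl fun k hk => ?_
    rw [hg k hk, zsmul_eq_mul]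
    have e : ℓ * m / (k * (ℓ * q)) = m / (q * k) := by
      rw [show k * (ℓ * q) = ℓ * (q * k) by ring, Nat.mul_div_mul_left _ _ hl0]
    rw [e]
    split_ifs <;> simp
  · refine Finset.sum_eq_zero fun k hk => ?_
    rw [hg k hk, if_neg fun h => hqm (dvd_of_mul_right_dvd h), smul_zero]

theorem card_necklace_weight (hn : 0 < n) (m : ℕ) {c : ℤ} (hc : c = n - 2 * m) :
    (Nat.card {x : Necklace n // x.weight = c} : ℚ) = n.choose m - S n m := by
  classical
  rw [card_sameCycle_quotient_eq_sum]
  have h (w : Fin n → Fin 2) : (Necklace.weight (n := n) (Quotient.mk _ w) = c) ↔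
      zeroCount w = m := by
    change wordWeight w = c ↔ _
    rw [wordWeight_eq, hc]; omega
  simp only [h]
  have hchoose := card_filter_card_fiber_zero_eq (Fin n) m
  rw [Fintype.card_fin] at hchoose
  rw [eq_sub_iff_add_eq, ← hchoose, Finset.card_eq_sum_ones, Nat.cast_sum]
  have hS : ∀ ℓ ∈ n.divisors, (if n ∣ ℓ * m then (((ℓ : ℚ) - 1) / (ℓ : ℚ)) *
      ∑ k ∈ (Nat.gcd ℓ (ℓ * m / n)).divisors,
        ((ArithmeticFunction.moebius k : ℤ) : ℚ) * ((ℓ / k).choose (ℓ * m / (k * n)) : ℚ) else 0) =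
      ∑ w : Fin n → Fin 2 with zeroCount w = m ∧ Function.minimalPeriod (wordShift n) w = ℓ,
        (1 - ((Function.minimalPeriod (wordShift n) w : ℕ) : ℚ)⁻¹) := by
    intro ℓ hl
    have hl0 : (ℓ : ℚ) ≠ 0 := by exact_mod_cast (Nat.pos_of_mem_divisors hl).ne'
    have hR : ∑ w : Fin n → Fin 2 with
        zeroCount w = m ∧ Function.minimalPeriod (wordShift n) w = ℓ,
        (1 - ((Function.minimalPeriod (wordShift n) w : ℕ) : ℚ)⁻¹) =
        ∑ w : Fin n → Fin 2 with
          zeroCount w = m ∧ Function.minimalPeriod (wordShift n) w = ℓ, (1 - (ℓ : ℚ)⁻¹) :=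
      Finset.sum_congr rfl fun w hw => by rw [((Finset.mem_filter_univ _).1 hw).2]
    rw [hR, Finset.sum_const, nsmul_eq_mul,
      card_zeroCount_minimalPeriod hn (Nat.dvd_of_mem_divisors hl)]
    split_ifs
    · rw [mul_comm, sub_div, div_self hl0, one_div]
    · simp
  rw [show S n m = _ from (Finset.sum_filter _ _).trans (Finset.sum_congr rfl hS)]
  simp only [← Finset.filter_filter]
  rw [Finset.sum_fiberwise_of_maps_to, ← Finset.sum_add_distrib]
  · refine Finset.sum_congr rfl fun w _ => by simp
  · intro w _
    exact Nat.mem_divisors.2 ⟨minimalPeriod_wordShift_dvd w, hn.ne'⟩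

end Counting

/-!
STATEMENT 9: for n ≥ 1 and 0 ≤ m with 2m ≤ n, the space of highest weight vectors
of weight n − 2m in the quotient sl₂-module V^⊗n/Cₙ has complex dimension
binom(n,m) − binom(n,m−1) − S(n,m) + S(n,m−1), with binom(n,−1) := 0 and
S(n,−1) := 0.

Since Cₙ is stable under the sl₂-action, a class v̄ ∈ V^⊗n/Cₙ satisfies
H·v̄ = (n−2m)·v̄ and E·v̄ = 0 iff some (equivalently, any) representative v
satisfies H·v − (n−2m)·v ∈ Cₙ and E·v ∈ Cₙ; so the space of highest weight vectors
of the quotient is the image under the quotient map of the subspace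
{v : H·v − (n−2m)v ∈ Cₙ} ∩ {v : E·v ∈ Cₙ}.
-/
theorem stmt_9 (n m : ℕ) (hn : 1 ≤ n) (hm : 2 * m ≤ n) :
    (Module.finrank ℂ
      ↥((Submodule.comap (derivAction n Hmat - ((n : ℂ) - 2 * m) • LinearMap.id) (Cyc n) ⊓
         Submodule.comap (derivAction n Emat) (Cyc n)).map (Cyc n).mkQ) : ℚ) =
    (n.choose m : ℚ) - (if m = 0 then 0 else (n.choose (m - 1) : ℚ))
      - S n m + (if m = 0 then 0 else S n (m - 1)) := by
  have h := finrank_map_mkQ_highest_weight_add (n := n) (n - 2 * m)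
  have hc : ((n - 2 * m : ℕ) : ℂ) = (n : ℂ) - 2 * m := by push_cast [Nat.cast_sub hm]; rfl
  rw [hc] at h
  have hQ := congrArg (Nat.cast : ℕ → ℚ) h
  rw [Nat.cast_add,
    card_necklace_weight hn m (c := ((n - 2 * m : ℕ) : ℤ)) (by omega)] at hQ
  split_ifs with hm0
  · subst hm0
    have h0 : Nat.card {x : Necklace n // x.weight = ((n - 2 * 0 : ℕ) : ℤ) + 2} = 0 := by
      rw [Nat.card_eq_zero]
      refine .inl ⟨fun ⟨x, hx⟩ => ?_⟩
      obtain ⟨w, rfl⟩ := x.exists_mk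
      change wordWeight w = _ at hx
      rw [wordWeight_eq] at hx
      omega
    rw [h0, Nat.cast_zero (R := ℚ)] at hQ
    linear_combination hQ
  · rw [card_necklace_weight hn (m - 1) (c := ((n - 2 * m : ℕ) : ℤ) + 2) (by omega)] at hQ
    linear_combination hQ
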